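/- Let 𝔸 be a commutative ring with identity, a, b ∈ 𝔸, and n ≥ 1. Define the sequence p_m^n(a,b) ∈ 𝔸 by p_0^n(a,b) = 0 and p_m^n(a,b) = (a + n·b)·p_{m−1}^n(a,b) + b·a^{m−1} for m ≥ 1. Then for every m ≥ 1, the m-th matrix power satisfies K_n(a,b)^m = K_n(a^m, p_m^n(a,b)). -/

import Mathlib

/-- The matrix `K_n(a,b) = (a+b)·I_n + b·A(K_n)`: diagonal entries `a+b`,
off-diagonal entries `b`. -/
def Kmat {A : Type*} [CommRing A] (n : ℕ) (a b : A) : Matrix (Fin n) (Fin n) A :=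
  Matrix.of fun i j => if i = j then a + b else b

/-- The sequence `p_m^n(a,b)` with `p_0 = 0` and
`p_m = (a + n·b)·p_{m-1} + b·a^(m-1)` for `m ≥ 1`. -/
def pseq {A : Type*} [CommRing A] (a b : A) (n : ℕ) : ℕ → A
  | 0 => 0
  | m + 1 => (a + (n : A) * b) * pseq a b n m + b * a ^ m

theorem Kmat_apply {A : Type*} [CommRing A] (n : ℕ) (a b : A) (i j : Fin n) :
    Kmat n a b i j = (if i = j then a else 0) + b := by
  simp only [Kmat, Matrix.of_apply]
  split_ifs <;> simp

theorem Kmat_mul {A : Type*} [CommRing A] (n : ℕ) (a b c d : A) :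
    Kmat n a b * Kmat n c d = Kmat n (a * c) (a * d + b * c + n * (b * d)) := by
  ext i j
  simp only [Matrix.mul_apply, Kmat_apply, add_mul, mul_add, Finset.sum_add_distrib, ite_mul,
    zero_mul, mul_ite, mul_zero, Finset.sum_ite_eq, Finset.sum_ite_eq', Finset.mem_univ, if_true,
    Finset.sum_const, Finset.card_univ, Fintype.card_fin, nsmul_eq_mul]
  split_ifs <;> ring

theorem Kmat_one_zero {A : Type*} [CommRing A] (n : ℕ) :
    Kmat n (1 : A) 0 = 1 := by
  ext i j
  simp [Kmat_apply, Matrix.one_apply]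

/-- For every `m ≥ 1`, `K_n(a,b)^m = K_n(a^m, p_m^n(a,b))`. -/
theorem Kmat_pow {A : Type*} [CommRing A] (n : ℕ) (hn : 1 ≤ n) (a b : A)
    (m : ℕ) (hm : 1 ≤ m) :
    Kmat n a b ^ m = Kmat n (a ^ m) (pseq a b n m) := by
  clear hm
  induction m with
  | zero => simp [pseq, Kmat_one_zero]
  | succ m ih =>
    rw [pow_succ, ih, Kmat_mul, pow_succ, pseq]
    congr 1
    ring
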